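/- Let X and Y be distinguished subsets of OT_N, and let α be a term such that α ≤ γ for some γ ∈ X and α ≤ δ for some δ ∈ Y. Then X ∩ α⁺ = Y ∩ α⁺. -/

import Mathlib

open scoped Classical

namespace ArOT

/-- An axiomatic presentation of Arai's computable notation system `OT_N` of ordinal terms
over the symbols `{0, S, +, φ, Ω, ψ}` (Definition 2.17 of the paper), with its subset
`Ψ_N` of collapsing terms below `S` and its term-comparison order `<`.
`Term` is the type of terms of `OT_N`, generated (cf. the field `ind`) by the term
constructors; `Fn` is the type of the attached irreducible finite functions `f`,
and `Kf f` is the finite set `K(f)` of components of `f`. -/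
structure OTCtx (N : ℕ) : Type 1 where
  /-- the terms of `OT_N` -/
  Term : Type
  /-- the term-comparison order of Proposition 2.13 / 2.19 -/
  lt : Term → Term → Prop
  lt_trans : ∀ {a b c : Term}, lt a b → lt b c → lt a c
  lt_irrefl : ∀ a : Term, ¬ lt a a
  lt_trich : ∀ a b : Term, lt a b ∨ a = b ∨ lt b a
  /-- the term `0` -/
  zero : Term
  /-- the term `Ω₁` -/
  om1 : Term
  /-- the term `S` (the stable ordinal `𝕊`) -/
  SS : Term
  /-- the terms `Ω_{S+n}` for `0 < n ≤ N` -/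
  omS : ℕ → Term
  /-- (normal-form) sums -/
  add : Term → Term → Term
  /-- Veblen terms `φβγ` -/
  phi : Term → Term → Term
  /-- the terms `Ω_{κ+n}` for `κ ∈ Ψ_N`, `0 < n ≤ N` -/
  omP : Term → ℕ → Term
  /-- the finite functions attached to collapsing terms -/
  Fn : Type
  /-- `K(f)`, the set of components of a finite function `f` -/
  Kf : Fn → Set Term
  /-- the collapsing terms `ψ_π^f(a)`: `psi π f a` -/
  psi : Term → Fn → Term → Term
  /-- `Ψ_N`: the set of collapsing terms below `S` -/
  Psi : Set Term
  /-- the terms of the form `Ω_{a+1}` -/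
  IsOmSucc : Set Term
  omSucc_om1 : om1 ∈ IsOmSucc
  omSucc_omS : ∀ n : ℕ, omS n ∈ IsOmSucc
  omSucc_omP : ∀ (κ : Term) (n : ℕ), omP κ n ∈ IsOmSucc
  zero_lt : ∀ t : Term, t ≠ zero → lt zero t
  Psi_lt_SS : ∀ σ ∈ Psi, lt σ SS
  psi_mem_Psi : ∀ (π : Term) (f : Fn) (a : Term), π ∈ Psi ∪ {SS} → psi π f a ∈ Psi
  /-- every term of `OT_N` is generated by the term constructors -/
  ind : ∀ P : Term → Prop,
    P zero → P om1 → P SS →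
    (∀ n : ℕ, 0 < n → n ≤ N → P (omS n)) →
    (∀ x y, P x → P y → P (add x y)) →
    (∀ x y, P x → P y → P (phi x y)) →
    (∀ (κ : Term) (n : ℕ), κ ∈ Psi → 0 < n → n ≤ N → P κ → P (omP κ n)) →
    (∀ (π : Term) (f : Fn) (a : Term), P π → P a → (∀ x ∈ Kf f, P x) → P (psi π f a)) →
    ∀ t : Term, P t

variable {N : ℕ}

/-- `x < α⁺`, where `α⁺` is the least term of the form `Ω_{a+1}` above `α`
(and `α⁺ = ∞` if there is none): `x` is below every such term above `α`. -/
def ltP (S : OTCtx N) (α x : S.Term) : Prop :=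
  ∀ β, β ∈ S.IsOmSucc → S.lt α β → S.lt x β

/-- Membership in the set `C^α(X)`: the closure of
`{0, Ω₁, S} ∪ {Ω_{S+n} : 0 < n ≤ N} ∪ (X ∩ α)` under `+`, `σ ↦ Ω_{σ+n}` (`σ ∈ Ψ_N`),
`(β,γ) ↦ φβγ`, and `(σ,β,f) ↦ ψ_σ^f(β)` for `σ > α` (Definition 3.1 of the paper). -/
inductive CMem (S : OTCtx N) (α : S.Term) (X : Set S.Term) : S.Term → Prop
  | zero : CMem S α X S.zero
  | om1 : CMem S α X S.om1
  | SS : CMem S α X S.SS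
  | omS (n : ℕ) : 0 < n → n ≤ N → CMem S α X (S.omS n)
  | ofX (x : S.Term) : x ∈ X → S.lt x α → CMem S α X x
  | add (x y : S.Term) : CMem S α X x → CMem S α X y → CMem S α X (S.add x y)
  | phi (x y : S.Term) : CMem S α X x → CMem S α X y → CMem S α X (S.phi x y)
  | omP (σ : S.Term) (n : ℕ) : σ ∈ S.Psi → 0 < n → n ≤ N → CMem S α X σ →
      CMem S α X (S.omP σ n)
  | psi (σ : S.Term) (f : S.Fn) (β : S.Term) : S.lt α σ → CMem S α X σ → CMem S α X β →
      (∀ x ∈ S.Kf f, CMem S α X x) → CMem S α X (S.psi σ f β)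

/-- The set `C^α(X)`. -/
def Cset (S : OTCtx N) (α : S.Term) (X : Set S.Term) : Set S.Term := {x | CMem S α X x}

/-- The well-founded part `W(X)` of `X` with respect to `<`. -/
def Wpart (S : OTCtx N) (X : Set S.Term) : Set S.Term :=
  {x | x ∈ X ∧ Acc (fun a b : S.Term => S.lt a b ∧ a ∈ X ∧ b ∈ X) x}

/-- `α ≤ X`: `α ≤ γ` for some `γ ∈ X`. -/
def leSome (S : OTCtx N) (α : S.Term) (X : Set S.Term) : Prop :=
  ∃ γ ∈ X, S.lt α γ ∨ α = γ

/-- `X` is a distinguished set, `D[X]` (Definition 3.4):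
`∀α (α ≤ X → W(C^α(X)) ∩ α⁺ = X ∩ α⁺)`. -/
def Dst (S : OTCtx N) (X : Set S.Term) : Prop :=
  ∀ α, leSome S α X →
    Wpart S (Cset S α X) ∩ {x | ltP S α x} = X ∩ {x | ltP S α x}

/-- `𝒲`, the union of all distinguished sets. -/
def maxW (S : OTCtx N) : Set S.Term := {x | ∃ X, Dst S X ∧ x ∈ X}

/-- `𝒢 = {α ∈ OT_N : α ∈ C^α(𝒲) ∧ C^α(𝒲) ∩ α ⊆ 𝒲}` (Definition 3.9). -/
def calG (S : OTCtx N) : Set S.Term :=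
  {α | CMem S α (maxW S) α ∧ ∀ x, CMem S α (maxW S) x → S.lt x α → x ∈ maxW S}

/-- `π ≺ κ`: the transitive closure of `{(π,κ) : π = ψ_κ^f(b)}` (Definition 3.7). -/
def prec (S : OTCtx N) : S.Term → S.Term → Prop :=
  Relation.TransGen fun π κ => ∃ (f : S.Fn) (b : S.Term), π = S.psi κ f b

section

variable {S : OTCtx N} {X Y : Set S.Term} {α : S.Term}

theorem ltP_self (α : S.Term) : ltP S α α := fun _ _ h => h

theorem CMem.mono_below (h : ∀ x ∈ X, S.lt x α → x ∈ Y) {t : S.Term} (ht : CMem S α X t) :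
    CMem S α Y t := by
  induction ht with
  | zero => exact .zero
  | om1 => exact .om1
  | SS => exact .SS
  | omS n h0 hn => exact .omS n h0 hn
  | ofX x hx hlt => exact .ofX x (h x hx hlt) hlt
  | add x y _ _ ihx ihy => exact .add x y ihx ihy
  | phi x y _ _ ihx ihy => exact .phi x y ihx ihy
  | omP σ n hσ h0 hn _ ih => exact .omP σ n hσ h0 hn ih
  | psi σ f β hlt _ _ _ ihσ ihβ ihf => exact .psi σ f β hlt ihσ ihβ ihf

theorem Cset_congr_below (h : ∀ x, S.lt x α → (x ∈ X ↔ x ∈ Y)) : Cset S α X = Cset S α Y :=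
  Set.ext fun _ => ⟨CMem.mono_below fun x hx hlt => (h x hlt).1 hx,
    CMem.mono_below fun x hx hlt => (h x hlt).2 hx⟩

theorem Dst.inter_eq_of_agree_below (hX : Dst S X) (hY : Dst S Y) (hαX : leSome S α X)
    (hαY : leSome S α Y) (h : ∀ x, S.lt x α → (x ∈ X ↔ x ∈ Y)) :
    X ∩ {x | ltP S α x} = Y ∩ {x | ltP S α x} := by
  rw [← hX α hαX, ← hY α hαY, Cset_congr_below h]

theorem leSome_of_mem (h : α ∈ X) : leSome S α X := ⟨α, h, .inr rfl⟩

theorem leSome_of_lt {β : S.Term} (hβ : S.lt β α) (h : leSome S α X) : leSome S β X := by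
  obtain ⟨γ, hγ, hlt | rfl⟩ := h
  · exact ⟨γ, hγ, .inl (S.lt_trans hβ hlt)⟩
  · exact ⟨α, hγ, .inl hβ⟩

/-- A distinguished set is well-founded: below one of its elements `γ` it is contained in
`C^γ(X)`, of whose well-founded part `γ` is an element. -/
theorem Dst.wellFoundedOn (hX : Dst S X) : X.WellFoundedOn S.lt := by
  refine ⟨fun ⟨γ, hγ⟩ => ?_⟩
  have hW : γ ∈ Wpart S (Cset S γ X) ∩ {x | ltP S γ x} := by
    rw [hX γ (leSome_of_mem hγ)]
    exact ⟨hγ, ltP_self γ⟩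
  obtain ⟨⟨hC, hacc⟩, -⟩ := hW
  have key : ∀ x, Acc (fun a b => S.lt a b ∧ a ∈ Cset S γ X ∧ b ∈ Cset S γ X) x →
      x ∈ Cset S γ X → (S.lt x γ ∨ x = γ) → ∀ hx : x ∈ X,
      Acc (Subrel S.lt (· ∈ X)) ⟨x, hx⟩ := by
    intro x hacc
    induction hacc with
    | intro x _ ih =>
      intro hxC hle hx
      refine ⟨_, fun ⟨y, hy⟩ hyx => ?_⟩
      have hyγ : S.lt y γ := by
        rcases hle with hlt | rfl
        · exact S.lt_trans hyx hlt
        · exact hyx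
      have hyC : y ∈ Cset S γ X := .ofX y hy hyγ
      exact ih y ⟨hyx, hyC, hxC⟩ hyC (.inl hyγ) hy
  exact key γ hacc hC (.inr rfl) hγ

theorem Dst.agree_below (hX : Dst S X) (hY : Dst S Y) (hαX : leSome S α X)
    (hαY : leSome S α Y) : ∀ x, S.lt x α → (x ∈ X ↔ x ∈ Y) := by
  have : IsStrictOrder S.Term S.lt :=
    { irrefl := S.lt_irrefl, trans := fun _ _ _ => S.lt_trans }
  have hwf : (X ∪ Y).WellFoundedOn S.lt := hX.wellFoundedOn.union hY.wellFoundedOn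
  have key : ∀ x ∈ X ∪ Y, S.lt x α → (x ∈ X ↔ x ∈ Y) := by
    intro x hx
    refine hwf.induction (P := fun x => S.lt x α → (x ∈ X ↔ x ∈ Y)) hx fun y _ ih hyα => ?_
    have heq := hX.inter_eq_of_agree_below hY (leSome_of_lt hyα hαX) (leSome_of_lt hyα hαY)
      fun z hzy => by
        by_cases hz : z ∈ X ∪ Y
        · exact ih z hz hzy (S.lt_trans hzy hyα)
        · exact ⟨fun h => (hz (.inl h)).elim, fun h => (hz (.inr h)).elim⟩
    have hiff := Set.ext_iff.1 heq y
    exact ⟨fun h => (hiff.1 ⟨h, ltP_self y⟩).1, fun h => (hiff.2 ⟨h, ltP_self y⟩).1⟩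
  exact fun x hlt => ⟨fun h => (key x (.inl h) hlt).1 h, fun h => (key x (.inr h) hlt).2 h⟩

end

/-- Proposition 3.6: for distinguished sets `X, Y` and a term `α` with `α ≤ X` and
`α ≤ Y`, one has `X ∩ α⁺ = Y ∩ α⁺`. -/
theorem stmt15 {N : ℕ} (S : OTCtx N) (X Y : Set S.Term)
    (hX : Dst S X) (hY : Dst S Y) (α : S.Term)
    (hαX : leSome S α X) (hαY : leSome S α Y) :
    X ∩ {x | ltP S α x} = Y ∩ {x | ltP S α x} :=
  hX.inter_eq_of_agree_below hY hαX hαY (hX.agree_below hY hαX hαY)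

end ArOT
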